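/- Let S ⊂ V(G) be a subset of vertices such that every vertex v in bS is adjacent to at least K₀ ≥ 1 vertices of S and S ∪ bS = V(G). If 0 < ω < K₀/4, then there exists a family of functions Θ_u ∈ PW_ω(L), indexed by u ∈ S, such that every f ∈ PW_ω(L) admits the reconstruction formula f = Σ_{u∈S} f(u)·Θ_u, the series converging unconditionally in L₂(G). -/

import Mathlib

open scoped BigOperators ENNReal

variable {V : Type*}

noncomputable def lapl (G : SimpleGraph V) [DecidableRel G.Adj] [G.LocallyFinite]
    (f : V → ℂ) (v : V) : ℂ :=
  ∑ u ∈ G.neighborFinset v, (f v - f u)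

/-- The Paley–Wiener space `PW_ω(L)` inside `L₂(G) = ℓ²(V)`: all `f` satisfying the
Bernstein inequality `‖L^k f‖ ≤ ω^k ‖f‖` for all `k ∈ ℕ`. -/
noncomputable def PW (G : SimpleGraph V) [DecidableRel G.Adj] [G.LocallyFinite] (ω : ℝ) :
    Set (lp (fun _ : V => ℂ) 2) :=
  {f | ∀ k : ℕ, Real.sqrt (∑' v, ‖(lapl G)^[k] (⇑f) v‖ ^ 2) ≤ ω ^ k * ‖f‖}

def bdry (G : SimpleGraph V) (S : Set V) : Set V :=
  {v | v ∉ S ∧ ∃ u ∈ S, G.Adj u v}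

/-! ### Bernstein spaces of a symmetric operator -/

section Bernstein

variable {H : Type*} [NormedAddCommGroup H] [InnerProductSpace ℂ H]

/-- For a symmetric operator, geometric growth of `‖L ^ k x‖` at rate `ω`, with any constant,
upgrades to the Bernstein inequality. -/
lemma norm_pow_apply_le_of_geometric {L : H →L[ℂ] H}
    (hL : ∀ x y, inner ℂ (L x) y = inner ℂ x (L y)) {ω : ℝ} (hω : 0 < ω) {x : H} {C : ℝ}
    (hC : ∀ k : ℕ, ‖(L ^ k) x‖ ≤ C * ω ^ k) (k : ℕ) : ‖(L ^ k) x‖ ≤ ω ^ k * ‖x‖ := by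
  rcases eq_or_ne x 0 with rfl | hx
  · simp
  have hx' : 0 < ‖x‖ := norm_pos_iff.2 hx
  have hsymm : ∀ (k : ℕ) (x y : H), inner ℂ ((L ^ k) x) y = inner ℂ x ((L ^ k) y) := by
    intro k
    induction k with
    | zero => simp
    | succ k ih =>
      intro x y
      rw [pow_succ, mul_apply_eq_comp, ih, hL, ← mul_apply_eq_comp,
        ← pow_succ', ← pow_succ]
  have hdouble : ∀ k : ℕ, ‖(L ^ k) x‖ ^ 2 ≤ ‖x‖ * ‖(L ^ (2 * k)) x‖ := by
    intro k
    have h : ‖(L ^ k) x‖ ^ 2 = ‖inner ℂ x ((L ^ (2 * k)) x)‖ := by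
      rw [two_mul, pow_add, mul_apply_eq_comp, ← hsymm, inner_self_eq_norm_sq_to_K]
      simp
    exact h.trans_le (norm_inner_le_norm _ _)
  by_contra! hlt
  set r : ℝ := ‖(L ^ k) x‖ / (ω ^ k * ‖x‖) with hr
  have hr1 : 1 < r := by rwa [hr, one_lt_div (by positivity)]
  have hgrow : ∀ j : ℕ, r ^ 2 ^ j * (ω ^ (2 ^ j * k) * ‖x‖) ≤ ‖(L ^ (2 ^ j * k)) x‖ := by
    intro j
    induction j with
    | zero => simp [hr, div_mul_cancel₀ _ (show ω ^ k * ‖x‖ ≠ 0 by positivity)]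
    | succ j ih =>
      have h1 := pow_le_pow_left₀ (by positivity) ih 2
      have h2 := h1.trans (hdouble _)
      rw [← mul_assoc 2, ← pow_succ'] at h2
      refine le_of_mul_le_mul_left (le_trans (le_of_eq ?_) h2) hx'
      ring
  obtain ⟨j, hj⟩ := pow_unbounded_of_one_lt (C / ‖x‖) hr1
  have h1 : r ^ j ≤ r ^ 2 ^ j := pow_le_pow_right₀ hr1.le Nat.lt_two_pow_self.le
  have h2 := (hgrow j).trans (hC _)
  rw [mul_comm (ω ^ _), ← mul_assoc] at h2
  have h3 := le_of_mul_le_mul_right h2 (by positivity)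
  rw [div_lt_iff₀ hx'] at hj
  nlinarith

/-- The vectors satisfying the Bernstein inequality for a symmetric operator, as a subspace. -/
def bernsteinSubmodule (L : H →L[ℂ] H)
    (hL : ∀ x y, inner ℂ (L x) y = inner ℂ x (L y)) (ω : ℝ) (hω : 0 < ω) : Submodule ℂ H where
  carrier := {x | ∀ k : ℕ, ‖(L ^ k) x‖ ≤ ω ^ k * ‖x‖}
  zero_mem' := by simp
  add_mem' := by
    intro x y hx hy
    refine norm_pow_apply_le_of_geometric hL hω (C := ‖x‖ + ‖y‖) fun k => ?_
    rw [map_add]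
    refine (norm_add_le _ _).trans ((add_le_add (hx k) (hy k)).trans_eq ?_)
    ring
  smul_mem' := by
    intro c x hx k
    rw [map_smul, norm_smul, norm_smul, mul_left_comm]
    exact mul_le_mul_of_nonneg_left (hx k) (norm_nonneg c)

lemma isClosed_bernsteinSubmodule (L : H →L[ℂ] H)
    (hL : ∀ x y, inner ℂ (L x) y = inner ℂ x (L y)) (ω : ℝ) (hω : 0 < ω) :
    IsClosed (bernsteinSubmodule L hL ω hω : Set H) := by
  have h : (bernsteinSubmodule L hL ω hω : Set H) =
      ⋂ k : ℕ, {x | ‖(L ^ k) x‖ ≤ ω ^ k * ‖x‖} := by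
    ext x
    simp [bernsteinSubmodule]
  rw [h]
  exact isClosed_iInter fun k => isClosed_le (by fun_prop) (by fun_prop)

end Bernstein

/-- A bounded-below operator between Hilbert spaces has a bounded left inverse. -/
lemma exists_leftInverse_of_bounded_below {E F : Type*}
    [NormedAddCommGroup E] [InnerProductSpace ℂ E] [CompleteSpace E]
    [NormedAddCommGroup F] [InnerProductSpace ℂ F] [CompleteSpace F]
    (T : E →L[ℂ] F) (C : ℝ) (hT : ∀ x, ‖x‖ ≤ C * ‖T x‖) :
    ∃ R : F →L[ℂ] E, ∀ x, R (T x) = x := by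
  have hanti : AntilipschitzWith C.toNNReal T := T.antilipschitz_of_bound fun x =>
    (hT x).trans (mul_le_mul_of_nonneg_right (Real.le_coe_toNNReal C) (norm_nonneg _))
  have hclosed : IsClosed (Set.range T) := hanti.isClosed_range T.uniformContinuous
  have : CompleteSpace T.range := hclosed.completeSpace_coe
  refine ⟨(T.equivRange hanti.injective hclosed).symm.toContinuousLinearMap ∘L
    T.range.orthogonalProjectionOnto, fun x => ?_⟩
  have h : T.range.orthogonalProjectionOnto (T x) = T.equivRange hanti.injective hclosed x := by
    rw [ContinuousLinearMap.coe_equivRange]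
    exact Submodule.orthogonalProjectionOnto_mem_subspace_eq_self (T.rangeRestrict x)
  rw [ContinuousLinearMap.comp_apply, h]
  exact ContinuousLinearEquiv.symm_apply_apply _ x

/-! ### Composition operators on `ℓ²` -/

section Comp

variable {ι κ : Type*}

lemma ENNReal.tsum_comp_eq (φ : ι → κ) (g : κ → ℝ≥0∞) :
    ∑' i, g (φ i) = ∑' v, ((φ ⁻¹' {v}).encard : ℝ≥0∞) * g v := by
  rw [← ENNReal.tsum_fiberwise _ φ]
  refine tsum_congr fun v => ?_
  rw [← ENNReal.tsum_set_const]
  exact tsum_congr fun i => by rw [i.2]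

lemma memℓp_two_iff_tsum_enorm (f : ι → ℂ) :
    Memℓp f 2 ↔ ∑' i, ‖f i‖ₑ ^ 2 ≠ ∞ := by
  rw [memℓp_gen_iff (by simp)]
  simp only [ENNReal.toReal_ofNat, Real.rpow_ofNat]
  have h : ∀ i, ‖f i‖ₑ ^ 2 = ((‖f i‖₊ ^ 2 : NNReal) : ℝ≥0∞) := fun i => by
    simp [enorm_eq_nnnorm]
  simp_rw [h]
  rw [ENNReal.tsum_coe_ne_top_iff_summable, ← NNReal.summable_coe]
  simp

lemma lp.norm_sq_eq_tsum (f : lp (fun _ : ι => ℂ) 2) : ‖f‖ ^ 2 = ∑' i, ‖f i‖ ^ 2 := by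
  have := lp.norm_rpow_eq_tsum (p := 2) (by simp) f
  simpa using this

lemma lp.enorm_sq_eq_tsum (f : lp (fun _ : ι => ℂ) 2) : ‖f‖ₑ ^ 2 = ∑' i, ‖f i‖ₑ ^ 2 := by
  have hs : Summable fun i => ‖f i‖ ^ 2 := by
    simpa using (memℓp_gen_iff (p := 2) (by simp)).1 (lp.memℓp f)
  rw [← ofReal_norm, ← ENNReal.ofReal_pow (norm_nonneg _), lp.norm_sq_eq_tsum,
    ENNReal.ofReal_tsum_of_nonneg (fun _ => by positivity) hs]
  refine tsum_congr fun i => ?_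
  rw [← ofReal_norm, ENNReal.ofReal_pow (norm_nonneg _)]

lemma tsum_enorm_comp_le {φ : ι → κ} {D : ℕ} (hφ : ∀ v, (φ ⁻¹' {v}).encard ≤ D)
    (f : κ → ℂ) : ∑' i, ‖f (φ i)‖ₑ ^ 2 ≤ D * ∑' v, ‖f v‖ₑ ^ 2 := by
  rw [ENNReal.tsum_comp_eq φ (fun v => ‖f v‖ₑ ^ 2), ← ENNReal.tsum_mul_left]
  refine ENNReal.tsum_le_tsum fun v => mul_le_mul_left ?_ _
  exact_mod_cast ENat.toENNReal_le.2 (hφ v)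

/-- The composition operator `f ↦ f ∘ φ` on `ℓ²`, for `φ` with fibers of bounded size. -/
noncomputable def lpComp (φ : ι → κ) (D : ℕ) (hφ : ∀ v, (φ ⁻¹' {v}).encard ≤ D) :
    lp (fun _ : κ => ℂ) 2 →L[ℂ] lp (fun _ : ι => ℂ) 2 :=
  LinearMap.mkContinuous
    { toFun := fun f => ⟨fun i => f (φ i), (memℓp_two_iff_tsum_enorm _).2 <|
        ne_top_of_le_ne_top (ENNReal.mul_ne_top (by simp)
          ((memℓp_two_iff_tsum_enorm _).1 (lp.memℓp f))) (tsum_enorm_comp_le hφ f)⟩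
      map_add' := fun _ _ => rfl
      map_smul' := fun _ _ => rfl }
    (√D) (by
      intro f
      refine le_of_sq_le_sq ?_ (by positivity)
      rw [mul_pow, Real.sq_sqrt (by positivity)]
      refine (ENNReal.ofReal_le_ofReal_iff (by positivity)).1 ?_
      rw [ENNReal.ofReal_mul (by positivity), ENNReal.ofReal_pow (norm_nonneg _),
        ENNReal.ofReal_pow (norm_nonneg _), ofReal_norm, ofReal_norm, lp.enorm_sq_eq_tsum,
        lp.enorm_sq_eq_tsum, ENNReal.ofReal_natCast]
      exact tsum_enorm_comp_le hφ f)

variable {φ : ι → κ} {D : ℕ} (hφ : ∀ v, (φ ⁻¹' {v}).encard ≤ D)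

@[simp]
lemma lpComp_apply (f : lp (fun _ : κ => ℂ) 2) (i : ι) : lpComp φ D hφ f i = f (φ i) := rfl

lemma norm_lpComp_le (f : lp (fun _ : κ => ℂ) 2) : ‖lpComp φ D hφ f‖ ≤ √D * ‖f‖ :=
  (lpComp φ D hφ).le_of_opNorm_le (LinearMap.mkContinuous_norm_le _ (by positivity) _) f

lemma le_norm_lpComp {K : ℕ} (hK : ∀ v, (K : ℕ∞) ≤ (φ ⁻¹' {v}).encard)
    (f : lp (fun _ : κ => ℂ) 2) : √K * ‖f‖ ≤ ‖lpComp φ D hφ f‖ := by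
  refine le_of_sq_le_sq ?_ (by positivity)
  rw [mul_pow, Real.sq_sqrt (by positivity)]
  refine (ENNReal.ofReal_le_ofReal_iff (by positivity)).1 ?_
  rw [ENNReal.ofReal_mul (by positivity), ENNReal.ofReal_pow (norm_nonneg _),
    ENNReal.ofReal_pow (norm_nonneg _), ofReal_norm, ofReal_norm, lp.enorm_sq_eq_tsum,
    lp.enorm_sq_eq_tsum, ENNReal.ofReal_natCast, ← ENNReal.tsum_mul_left]
  simp only [lpComp_apply]
  rw [ENNReal.tsum_comp_eq φ (fun v => ‖f v‖ₑ ^ 2)]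
  refine ENNReal.tsum_le_tsum fun v => mul_le_mul_left ?_ _
  exact_mod_cast ENat.toENNReal_le.2 (hK v)

lemma encard_fiber_le_one (hinj : Function.Injective φ) (v : κ) :
    (φ ⁻¹' {v}).encard ≤ (1 : ℕ) := by
  rw [Nat.cast_one, Set.encard_le_one_iff]
  rintro a b rfl hb
  exact hinj hb.symm

open Classical in
lemma adjoint_lpComp_apply (g : lp (fun _ : ι => ℂ) 2) (v : κ) :
    (lpComp φ D hφ).adjoint g v = ∑' i, if φ i = v then g i else 0 := by
  have h := lp.inner_single_left (𝕜 := ℂ) v (1 : ℂ) ((lpComp φ D hφ).adjoint g)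
  rw [ContinuousLinearMap.adjoint_inner_right, lp.inner_eq_tsum] at h
  simp only [RCLike.inner_apply, map_one, mul_one, lpComp_apply, lp.single_apply] at h
  rw [← h]
  refine tsum_congr fun i => ?_
  by_cases hi : φ i = v
  · simp [hi]
  · simp [hi]

end Comp

/-! ### The Laplacian as a bounded operator -/

section Laplacian

variable (G : SimpleGraph V) [G.LocallyFinite]

lemma encard_dart_fst_fiber_le {D : ℕ} (hD : ∀ v, G.degree v ≤ D) (v : V) :
    ((fun d : G.Dart => d.fst) ⁻¹' {v}).encard ≤ D := by
  have hmaps : Set.MapsTo (fun d : G.Dart => d.snd) ((fun d : G.Dart => d.fst) ⁻¹' {v})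
      (G.neighborFinset v : Set V) := by
    rintro d rfl
    simp
  have hinj : Set.InjOn (fun d : G.Dart => d.snd) ((fun d : G.Dart => d.fst) ⁻¹' {v}) := by
    intro d hd e he h
    exact SimpleGraph.Dart.ext _ _ (Prod.ext (hd.trans he.symm) h)
  refine (Set.encard_le_encard_of_injOn hmaps hinj).trans ?_
  rw [Set.encard_coe_eq_coe_finsetCard, SimpleGraph.card_neighborFinset_eq_degree]
  exact_mod_cast hD v

lemma encard_dart_snd_fiber_le {D : ℕ} (hD : ∀ v, G.degree v ≤ D) (v : V) :
    ((fun d : G.Dart => d.snd) ⁻¹' {v}).encard ≤ D := by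
  refine (Set.encard_le_encard_of_injOn (f := SimpleGraph.Dart.symm) (fun d hd => ?_)
    SimpleGraph.Dart.symm_involutive.injective.injOn).trans (encard_dart_fst_fiber_le G hD v)
  exact hd

/-- The discrete gradient, sending `f` to its increments along darts. -/
noncomputable def dartGradient {D : ℕ} (hD : ∀ v, G.degree v ≤ D) :
    lp (fun _ : V => ℂ) 2 →L[ℂ] lp (fun _ : G.Dart => ℂ) 2 :=
  lpComp (fun d : G.Dart => d.fst) D (encard_dart_fst_fiber_le G hD) -
    lpComp (fun d : G.Dart => d.snd) D (encard_dart_snd_fiber_le G hD)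

/-- The combinatorial Laplacian as half the square of the gradient. -/
noncomputable def laplCLM {D : ℕ} (hD : ∀ v, G.degree v ≤ D) :
    lp (fun _ : V => ℂ) 2 →L[ℂ] lp (fun _ : V => ℂ) 2 :=
  (2⁻¹ : ℂ) • ((dartGradient G hD).adjoint ∘L dartGradient G hD)

variable {D : ℕ} (hD : ∀ v, G.degree v ≤ D)

@[simp]
lemma dartGradient_apply (f : lp (fun _ : V => ℂ) 2) (d : G.Dart) :
    dartGradient G hD f d = f d.fst - f d.snd := rfl

open Classical in
lemma tsum_dart_fst_eq (g : G.Dart → ℂ) (h : V → V → ℂ)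
    (hg : ∀ d : G.Dart, g d = h d.fst d.snd) (v : V) :
    (∑' d : G.Dart, if d.fst = v then g d else 0) = ∑ u ∈ G.neighborFinset v, h v u := by
  rw [← (G.dartOfNeighborSet_injective v).tsum_eq]
  · simp only [SimpleGraph.dartOfNeighborSet, if_true, hg]
    rw [tsum_fintype]
    exact (Finset.sum_subtype _ (fun u => G.mem_neighborFinset v u) _).symm
  · intro d hd
    obtain rfl : d.fst = v := by
      by_contra hne
      exact hd (if_neg hne)
    exact ⟨⟨d.snd, d.adj⟩, rfl⟩

lemma laplCLM_apply [DecidableRel G.Adj] (f : lp (fun _ : V => ℂ) 2) :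
    ⇑(laplCLM G hD f) = lapl G f := by
  classical
  ext v
  have hsnd : (∑' d : G.Dart, if d.snd = v then f d.fst - f d.snd else 0) =
      -∑ u ∈ G.neighborFinset v, (f v - f u) := by
    rw [← SimpleGraph.Dart.symm_involutive.toPerm.tsum_eq, ← Finset.sum_neg_distrib]
    exact tsum_dart_fst_eq G (fun d => f d.snd - f d.fst) (fun a b => -(f a - f b))
      (fun d => (neg_sub _ _).symm) v
  have hfst := tsum_dart_fst_eq G (fun d => f d.fst - f d.snd) (fun a b => f a - f b)
    (fun _ => rfl) v
  have hadj : (dartGradient G hD).adjoint =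
      (lpComp (fun d : G.Dart => d.fst) D (encard_dart_fst_fiber_le G hD)).adjoint -
      (lpComp (fun d : G.Dart => d.snd) D (encard_dart_snd_fiber_le G hD)).adjoint := by
    rw [dartGradient, map_sub]
  have happly : laplCLM G hD f v =
      (2⁻¹ : ℂ) * ((dartGradient G hD).adjoint (dartGradient G hD f)) v := rfl
  rw [happly, hadj, sub_apply, lp.coeFn_sub, Pi.sub_apply,
    adjoint_lpComp_apply, adjoint_lpComp_apply]
  simp only [dartGradient_apply]
  rw [hfst, hsnd, lapl]
  ring

lemma laplCLM_symm (f g : lp (fun _ : V => ℂ) 2) :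
    inner ℂ (laplCLM G hD f) g = inner ℂ f (laplCLM G hD g) := by
  simp [laplCLM, ContinuousLinearMap.adjoint_inner_left,
    ContinuousLinearMap.adjoint_inner_right, mul_comm]

lemma norm_dartGradient_sq_le (f : lp (fun _ : V => ℂ) 2) :
    ‖dartGradient G hD f‖ ^ 2 ≤ 2 * (‖f‖ * ‖laplCLM G hD f‖) := by
  have h : ((‖dartGradient G hD f‖ ^ 2 : ℝ) : ℂ) = 2 * inner ℂ f (laplCLM G hD f) := by
    simp [laplCLM, ContinuousLinearMap.adjoint_inner_right,
      inner_self_eq_norm_sq_to_K]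
  have h' := congrArg norm h
  rw [Complex.norm_real, Real.norm_of_nonneg (by positivity), norm_mul, Complex.norm_ofNat] at h'
  rw [h']
  exact mul_le_mul_of_nonneg_left (norm_inner_le_norm _ _) zero_le_two

lemma PW_eq_bernsteinSubmodule [DecidableRel G.Adj] (ω : ℝ) (hω : 0 < ω) :
    PW G ω = bernsteinSubmodule (laplCLM G hD) (laplCLM_symm G hD) ω hω := by
  ext f
  have hpow : ∀ k : ℕ, ⇑((laplCLM G hD ^ k) f) = (lapl G)^[k] f := by
    intro k
    induction k with
    | zero => rfl
    | succ k ih =>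
      rw [pow_succ', mul_apply_eq_comp, laplCLM_apply, ih, Function.iterate_succ_apply']
  refine forall_congr' fun k => ?_
  rw [← hpow, ← lp.norm_sq_eq_tsum, Real.sqrt_sq (norm_nonneg _)]

/-- Restriction of square-summable functions to a subset. -/
noncomputable def lpRestrict {κ : Type*} (S : Set κ) :
    lp (fun _ : κ => ℂ) 2 →L[ℂ] lp (fun _ : S => ℂ) 2 :=
  lpComp ((↑) : S → κ) 1 (encard_fiber_le_one Subtype.val_injective)

@[simp]
lemma lpRestrict_apply {κ : Type*} (S : Set κ) (f : lp (fun _ : κ => ℂ) 2) (v : S) :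
    lpRestrict S f v = f v := rfl

lemma norm_lpRestrict_le {κ : Type*} (S : Set κ) (f : lp (fun _ : κ => ℂ) 2) :
    ‖lpRestrict S f‖ ≤ ‖f‖ := by
  simpa [lpRestrict] using norm_lpComp_le (encard_fiber_le_one Subtype.val_injective) f

lemma norm_le_norm_lpRestrict_add {κ : Type*} (S : Set κ) (f : lp (fun _ : κ => ℂ) 2) :
    ‖f‖ ≤ ‖lpRestrict S f‖ + ‖lpRestrict Sᶜ f‖ := by
  have hs : Summable fun i => ‖f i‖ ^ 2 := by
    simpa using (memℓp_gen_iff (p := 2) (by simp)).1 (lp.memℓp f)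
  have h : ‖f‖ ^ 2 = ‖lpRestrict S f‖ ^ 2 + ‖lpRestrict Sᶜ f‖ ^ 2 := by
    simp only [lp.norm_sq_eq_tsum, lpRestrict_apply]
    exact (hs.subtype S |>.tsum_add_tsum_compl (hs.subtype Sᶜ)).symm
  refine le_of_sq_le_sq ?_ (by positivity)
  nlinarith [norm_nonneg (lpRestrict S f), norm_nonneg (lpRestrict Sᶜ f)]

/-- If every vertex outside `S` has at least `K` neighbors in `S`, the mass of `f` off `S` is
controlled by its gradient and its mass on `S`. -/
lemma sqrt_mul_norm_lpRestrict_compl_le (S : Set V) {K : ℕ}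
    (hK : ∀ v ∉ S, (K : ℕ∞) ≤ {u | u ∈ S ∧ G.Adj v u}.encard) (f : lp (fun _ : V => ℂ) 2) :
    √K * ‖lpRestrict Sᶜ f‖ ≤ ‖dartGradient G hD f‖ + √D * ‖lpRestrict S f‖ := by
  let E : Set G.Dart := {d | d.fst ∉ S ∧ d.snd ∈ S}
  let src : E → (Sᶜ : Set V) := fun d => ⟨d.1.fst, d.2.1⟩
  let tgt : E → S := fun d => ⟨d.1.snd, d.2.2⟩
  have hsrc : ∀ v, (src ⁻¹' {v}).encard ≤ D := by
    intro v
    refine (Set.encard_le_encard_of_injOn (f := Subtype.val) (fun d hd => ?_)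
      Subtype.val_injective.injOn).trans (encard_dart_fst_fiber_le G hD v)
    exact congrArg Subtype.val hd
  have htgt : ∀ v, (tgt ⁻¹' {v}).encard ≤ D := by
    intro v
    refine (Set.encard_le_encard_of_injOn (f := Subtype.val) (fun d hd => ?_)
      Subtype.val_injective.injOn).trans (encard_dart_snd_fiber_le G hD v)
    exact congrArg Subtype.val hd
  have hsrc' : ∀ v, (K : ℕ∞) ≤ (src ⁻¹' {v}).encard := by
    intro v
    refine (hK v v.2).trans ?_
    have himage : {u | u ∈ S ∧ G.Adj v u} ⊆
        (fun d : E => d.1.snd) '' (src ⁻¹' {v}) := by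
      rintro u ⟨huS, hvu⟩
      exact ⟨⟨⟨(v, u), hvu⟩, v.2, huS⟩, rfl, rfl⟩
    exact (Set.encard_le_encard himage).trans (Set.encard_image_le _ _)
  have hsplit : lpComp src D hsrc (lpRestrict Sᶜ f) =
      lpRestrict E (dartGradient G hD f) + lpComp tgt D htgt (lpRestrict S f) := by
    ext d
    exact (sub_add_cancel (f d.1.fst) (f d.1.snd)).symm
  calc √K * ‖lpRestrict Sᶜ f‖ ≤ ‖lpComp src D hsrc (lpRestrict Sᶜ f)‖ :=
        le_norm_lpComp hsrc hsrc' _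
    _ ≤ ‖lpRestrict E (dartGradient G hD f)‖ + ‖lpComp tgt D htgt (lpRestrict S f)‖ :=
        hsplit ▸ norm_add_le _ _
    _ ≤ ‖dartGradient G hD f‖ + √D * ‖lpRestrict S f‖ :=
        add_le_add (norm_lpRestrict_le _ _) (norm_lpComp_le _ _)

end Laplacian

theorem stmt12 [Countable V] (G : SimpleGraph V) [DecidableRel G.Adj] [G.LocallyFinite]
    (hconn : G.Connected) (D : ℕ) (hD : ∀ v, G.degree v ≤ D)
    (S : Set V) (K₀ : ℕ) (hK : 1 ≤ K₀)
    (hKS : ∀ v ∈ bdry G S, K₀ ≤ {u | u ∈ S ∧ G.Adj v u}.ncard)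
    (hcover : S ∪ bdry G S = Set.univ)
    (ω : ℝ) (hω : 0 < ω) (hωsmall : ω < (K₀ : ℝ) / 4) :
    ∃ Θ : S → lp (fun _ : V => ℂ) 2,
      (∀ u : S, Θ u ∈ PW G ω) ∧
      ∀ f ∈ PW G ω, HasSum (fun u : S => f (u : V) • Θ u) f := by
  have hadj : ∀ v ∉ S, (K₀ : ℕ∞) ≤ {u | u ∈ S ∧ G.Adj v u}.encard := by
    intro v hv
    have hfin : {u | u ∈ S ∧ G.Adj v u}.Finite :=
      (G.neighborFinset v).finite_toSet.subset fun u hu => by simpa using hu.2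
    rw [← hfin.cast_ncard_eq]
    exact_mod_cast hKS v ((hcover ▸ Set.mem_univ v : v ∈ S ∪ bdry G S).resolve_left hv)
  rw [PW_eq_bernsteinSubmodule G hD ω hω]
  set W := bernsteinSubmodule (laplCLM G hD) (laplCLM_symm G hD) ω hω
  have : CompleteSpace W :=
    (isClosed_bernsteinSubmodule (laplCLM G hD) (laplCLM_symm G hD) ω hω).completeSpace_coe
  have hgap : √(2 * ω) < √K₀ := Real.sqrt_lt_sqrt (by positivity) (by linarith)
  have hbelow : ∀ f : W, ‖f‖ ≤ (1 + (√(2 * ω) + √D) / (√K₀ - √(2 * ω))) *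
      ‖(lpRestrict S ∘L W.subtypeL) f‖ := by
    intro f
    have hgrad : ‖dartGradient G hD f‖ ≤ √(2 * ω) * ‖(f : lp (fun _ : V => ℂ) 2)‖ := by
      refine le_of_sq_le_sq ?_ (by positivity)
      rw [mul_pow, Real.sq_sqrt (by positivity)]
      have hf : ‖laplCLM G hD f‖ ≤ ω * ‖(f : lp (fun _ : V => ℂ) 2)‖ := by
        simpa using f.2 1
      nlinarith [norm_dartGradient_sq_le G hD f, norm_nonneg (f : lp (fun _ : V => ℂ) 2)]
    have hoff := sqrt_mul_norm_lpRestrict_compl_le G hD S hadj f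
    have hnorm := norm_le_norm_lpRestrict_add S (f : lp (fun _ : V => ℂ) 2)
    have hcompl : ‖lpRestrict Sᶜ (f : lp (fun _ : V => ℂ) 2)‖ ≤
        (√(2 * ω) + √D) / (√K₀ - √(2 * ω)) * ‖lpRestrict S (f : lp (fun _ : V => ℂ) 2)‖ := by
      rw [div_mul_eq_mul_div, le_div_iff₀ (by linarith)]
      nlinarith [mul_le_mul_of_nonneg_left hnorm (Real.sqrt_nonneg (2 * ω))]
    rw [add_mul, one_mul]
    exact hnorm.trans (add_le_add_right hcompl _)
  obtain ⟨R, hR⟩ := exists_leftInverse_of_bounded_below _ _ hbelow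
  classical
  refine ⟨fun u => R (lp.single 2 u 1), fun u => (R _).2, fun f hf => ?_⟩
  have hsum := ((W.subtypeL ∘L R).hasSum
    (lp.hasSum_single ENNReal.ofNat_ne_top (lpRestrict S f)))
  have hrec : (W.subtypeL ∘L R) (lpRestrict S f) = f := congrArg Subtype.val (hR ⟨f, hf⟩)
  rw [hrec] at hsum
  refine hsum.congr_fun fun u => ?_
  have hsingle : lp.single 2 u (f u) = f u • lp.single (E := fun _ : S => ℂ) 2 u 1 := by
    rw [← lp.single_smul, smul_eq_mul, mul_one]
  simp [hsingle]
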